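/- Let B be a connected graded k-bialgebra, r a natural number, and f: B ⊗ B → B a homogeneous linear map such that f(1 ⊗ a) = f(a ⊗ 1) = 0 for all a ∈ B and a f(b ⊗ c) − f(ab ⊗ c) + f(a ⊗ bc) − f(a ⊗ b) c = 0 for all a, b, c ∈ B (a unital Hochschild 2-cocycle with respect to the left and right regular actions of B on itself). If f_{<r} = 0, then f_r is an ε-cocycle with values in B regarded with the trivial action: f_r(1 ⊗ a) = f_r(a ⊗ 1) = 0 for all a ∈ B and f_r(xy ⊗ z) = f_r(x ⊗ yz) for all x, y, z ∈ B⁺. -/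

import Mathlib

/-!
STATEMENT 8: Let B be a connected graded k-bialgebra, r a natural number, and
f : B ⊗ B → B a homogeneous unital Hochschild 2-cocycle (for the left and right regular
actions of B on itself).  If f_{<r} = 0, then f_r is an ε-cocycle with values in B
with the trivial action.
-/

open TensorProduct

namespace Rigidity

noncomputable section

variable (k B : Type*) [Field k] [Ring B] [Bialgebra k B]

/-- The augmentation ideal `B⁺ = ker ε` of the bialgebra `B`. -/
def Bplus : Submodule k B := LinearMap.ker (Coalgebra.counit (R := k) (A := B))

/-- The subspace `B⁺ ⊗ B⁺` of `B ⊗ B`. -/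
def BpBp : Submodule k (B ⊗[k] B) :=
  LinearMap.range (TensorProduct.map (Bplus k B).subtype (Bplus k B).subtype)

variable (ℬ : ℕ → Submodule k B)

/-- The degree-`n` component `(B ⊗ B)_n = ⊕_{i+j=n} B_i ⊗ B_j` of `B ⊗ B`. -/
def tensorGrade (n : ℕ) : Submodule k (B ⊗[k] B) :=
  ⨆ (ij : ℕ × ℕ) (_ : ij.1 + ij.2 = n),
    LinearMap.range (TensorProduct.map (ℬ ij.1).subtype (ℬ ij.2).subtype)

/-- The grading of `B` reindexed by `ℤ` (with `⊥` in negative degrees). -/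
def gradeZ (z : ℤ) : Submodule k B := if 0 ≤ z then ℬ z.toNat else ⊥

/-- The grading of `B ⊗ B` reindexed by `ℤ` (with `⊥` in negative degrees). -/
def tensorGradeZ (z : ℤ) : Submodule k (B ⊗[k] B) :=
  if 0 ≤ z then tensorGrade k B ℬ z.toNat else ⊥

/-- `f : B ⊗ B → B` is homogeneous of degree `ℓ`. -/
def HomogF (ℓ : ℤ) (f : B ⊗[k] B →ₗ[k] B) : Prop :=
  ∀ (n : ℕ) (u : B ⊗[k] B), u ∈ tensorGrade k B ℬ n → f u ∈ gradeZ k B ℬ (n + ℓ)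

/-- `g : B → B ⊗ B` is homogeneous of degree `ℓ`. -/
def HomogG (ℓ : ℤ) (g : B →ₗ[k] B ⊗[k] B) : Prop :=
  ∀ (n : ℕ) (x : B), x ∈ ℬ n → g x ∈ tensorGradeZ k B ℬ (n + ℓ)

/-- `s : B → B` is homogeneous of degree `ℓ`. -/
def HomogE (ℓ : ℤ) (s : B →ₗ[k] B) : Prop :=
  ∀ (n : ℕ) (x : B), x ∈ ℬ n → s x ∈ gradeZ k B ℬ (n + ℓ)

/-- The comultiplication of the bialgebra `B ⊗ B`:
`a ⊗ b ↦ (a₍₁₎ ⊗ b₍₁₎) ⊗ (a₍₂₎ ⊗ b₍₂₎)`. -/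
def comul2 : B ⊗[k] B →ₗ[k] (B ⊗[k] B) ⊗[k] (B ⊗[k] B) :=
  (TensorProduct.tensorTensorTensorComm k B B B B).toLinearMap ∘ₗ
    TensorProduct.map Coalgebra.comul Coalgebra.comul

/-- `(f, g)` is a truncated bialgebra 2-cocycle of degree `ℓ` on the graded
bialgebra `B` (with grading `ℬ`).  Here `f : B⁺ ⊗ B⁺ → B⁺` and `g : B⁺ → B⁺ ⊗ B⁺`
are modelled as maps on `B ⊗ B` resp. `B` via the extensions
`f(1 ⊗ a) = f(a ⊗ 1) = 0` and `g(1) = 0`. -/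
def IsTruncCocycle (ℓ : ℤ) (f : B ⊗[k] B →ₗ[k] B) (g : B →ₗ[k] B ⊗[k] B) : Prop :=
  (∀ a : B, f ((1 : B) ⊗ₜ[k] a) = 0) ∧ (∀ a : B, f (a ⊗ₜ[k] (1 : B)) = 0) ∧
  (∀ u : B ⊗[k] B, f u ∈ Bplus k B) ∧
  g 1 = 0 ∧ (∀ x : B, g x ∈ BpBp k B) ∧
  HomogF k B ℬ ℓ f ∧ HomogG k B ℬ ℓ g ∧
  -- (i) the Hochschild cocycle condition:
  (∀ a b c : B, a ∈ Bplus k B → b ∈ Bplus k B → c ∈ Bplus k B →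
    a * f (b ⊗ₜ[k] c) + f (a ⊗ₜ[k] (b * c)) = f ((a * b) ⊗ₜ[k] c) + f (a ⊗ₜ[k] b) * c) ∧
  -- (ii) the coalgebra cocycle condition:
  (∀ c : B, c ∈ Bplus k B →
    LinearMap.lTensor B g (Coalgebra.comul c) + LinearMap.lTensor B Coalgebra.comul (g c)
      = TensorProduct.assoc k B B B (LinearMap.rTensor B Coalgebra.comul (g c))
        + TensorProduct.assoc k B B B (LinearMap.rTensor B g (Coalgebra.comul c))) ∧
  -- (iii) the compatibility condition:
  (∀ a b : B, a ∈ Bplus k B → b ∈ Bplus k B →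
    TensorProduct.map f (LinearMap.mul' k B) (comul2 k B (a ⊗ₜ[k] b))
      + TensorProduct.map (LinearMap.mul' k B) f (comul2 k B (a ⊗ₜ[k] b))
      - Coalgebra.comul (f (a ⊗ₜ[k] b))
      = -(Coalgebra.comul (R := k) a * g b) + g (a * b) - g a * Coalgebra.comul (R := k) b)


/-- The sum of all the components of `B ⊗ B` of degree different from `r`. -/
def coGrade (r : ℕ) : Submodule k (B ⊗[k] B) :=
  ⨆ (n : ℕ) (_ : n ≠ r), tensorGrade k B ℬ n

section

variable {k B} {ℬ}

theorem tmul_mem_tensorGrade {i j : ℕ} {x y : B} (hx : x ∈ ℬ i) (hy : y ∈ ℬ j) :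
    x ⊗ₜ[k] y ∈ tensorGrade k B ℬ (i + j) :=
  Submodule.mem_iSup_of_mem (i, j) <| Submodule.mem_iSup_of_mem rfl
    ⟨(⟨x, hx⟩ : ℬ i) ⊗ₜ[k] (⟨y, hy⟩ : ℬ j), by simp⟩

theorem tensorGrade_le {n : ℕ} {S : Submodule k (B ⊗[k] B)}
    (h : ∀ i j, i + j = n → ∀ x ∈ ℬ i, ∀ y ∈ ℬ j, x ⊗ₜ[k] y ∈ S) :
    tensorGrade k B ℬ n ≤ S := by
  refine iSup₂_le fun ij hij => ?_
  rintro _ ⟨t, rfl⟩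
  induction t with
  | zero => simp
  | add a b ha hb => rw [map_add]; exact S.add_mem ha hb
  | tmul a b => exact h ij.1 ij.2 hij a a.2 b b.2

/-- The projections of `B` onto the components of an internal grading. -/
theorem exists_grade_proj (hinternal : DirectSum.IsInternal ℬ) :
    ∃ P : ℕ → B →ₗ[k] B, ∀ i j, ∀ x ∈ ℬ j, P i x = if i = j then x else 0 := by
  let e := LinearEquiv.ofBijective (DirectSum.coeLinearMap ℬ) hinternal
  refine ⟨fun i => (ℬ i).subtype ∘ₗ DirectSum.component k ℕ (fun i => ℬ i) i ∘ₗ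
    e.symm.toLinearMap, fun i j x hx => ?_⟩
  have he : e.symm x = DirectSum.lof k ℕ (fun i => ℬ i) j ⟨x, hx⟩ := by
    rw [LinearEquiv.symm_apply_eq]
    exact (DirectSum.coeLinearMap_lof ℬ j ⟨x, hx⟩).symm
  simp only [LinearMap.comp_apply, LinearEquiv.coe_coe, he]
  split_ifs with h
  · subst h
    rw [DirectSum.component.lof_self]
    rfl
  · rw [DirectSum.component.of, dif_neg (Ne.symm h), map_zero]

/-- The projection of `B ⊗ B` onto its degree-`r` component. -/
theorem exists_tensorGrade_proj (hinternal : DirectSum.IsInternal ℬ) (r : ℕ) :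
    ∃ Q : B ⊗[k] B →ₗ[k] B ⊗[k] B, (∀ u ∈ tensorGrade k B ℬ r, Q u = u) ∧
      ∀ v ∈ coGrade k B ℬ r, Q v = 0 := by
  obtain ⟨P, hP⟩ := exists_grade_proj hinternal
  refine ⟨∑ p ∈ Finset.HasAntidiagonal.antidiagonal r, TensorProduct.map (P p.1) (P p.2), ?_, ?_⟩
  · suffices h : tensorGrade k B ℬ r ≤ LinearMap.eqLocus
        (∑ p ∈ Finset.HasAntidiagonal.antidiagonal r, TensorProduct.map (P p.1) (P p.2)) LinearMap.id from
      fun u hu => h hu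
    refine tensorGrade_le fun i j hij x hx y hy => ?_
    rw [LinearMap.mem_eqLocus, LinearMap.sum_apply, LinearMap.id_apply,
      Finset.sum_eq_single_of_mem (i, j) (by simpa using hij)]
    · simp [hP i i x hx, hP j j y hy]
    · rintro ⟨a, b⟩ - hab
      rw [TensorProduct.map_tmul, hP a i x hx, hP b j y hy]
      by_cases ha : a = i
      · have hb : b ≠ j := fun hb => hab (by rw [ha, hb])
        simp [hb]
      · simp [ha]
  · suffices h : coGrade k B ℬ r ≤ LinearMap.ker
        (∑ p ∈ Finset.HasAntidiagonal.antidiagonal r, TensorProduct.map (P p.1) (P p.2)) from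
      fun v hv => h hv
    refine iSup₂_le fun n hn => tensorGrade_le fun i j hij x hx y hy => ?_
    rw [LinearMap.mem_ker, LinearMap.sum_apply]
    refine Finset.sum_eq_zero fun p hp => ?_
    rw [Finset.HasAntidiagonal.mem_antidiagonal] at hp
    rw [TensorProduct.map_tmul, hP _ i x hx, hP _ j y hy]
    by_cases ha : p.1 = i
    · have hb : p.2 ≠ j := by omega
      simp [hb]
    · simp [ha]

theorem Bplus_le_iSup (hinternal : DirectSum.IsInternal ℬ)
    (hcounit : ∀ (n : ℕ) (x : B), x ∈ ℬ (n + 1) → Coalgebra.counit (R := k) x = (0 : k))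
    (hconn : ℬ 0 = (1 : Submodule k B)) :
    Bplus k B ≤ ⨆ n, ℬ (n + 1) := by
  have key : ∀ b : B, b - algebraMap k B (Coalgebra.counit (R := k) b) ∈ ⨆ n, ℬ (n + 1) := by
    intro b
    have hb : b ∈ ⨆ n, ℬ n := by simp [hinternal.submodule_iSup_eq_top]
    induction hb using Submodule.iSup_induction' with
    | zero => simp
    | add x y _ _ hx hy =>
      rw [map_add, map_add, add_sub_add_comm]
      exact add_mem hx hy
    | mem n x hx =>
      cases n with
      | zero =>
        rw [hconn, Submodule.mem_one] at hx
        obtain ⟨c, rfl⟩ := hx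
        simp
      | succ n =>
        rw [hcounit n x hx, map_zero, sub_zero]
        exact Submodule.mem_iSup_of_mem n hx
  intro b hb
  have h := key b
  rwa [LinearMap.mem_ker.mp hb, map_zero, sub_zero] at h

end

/-- let `B` be a connected graded bialgebra, `r` a natural number and
`f : B ⊗ B → B` a homogeneous unital Hochschild cocycle (with respect to the left and
right regular actions of `B` on itself).  If `f_{<r} = 0`, then `f_r` is an ε-cocycle.
(The component `f_r` is encoded by decomposing each relevant element of `B ⊗ B` as
`u + v` with `u` of degree `r` and `v` a sum of components of degrees `≠ r`, so that
`f_r` takes the value `f u`.) -/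
theorem stmt_8 (k B : Type*) [Field k] [CharZero k] [Ring B] [Bialgebra k B]
    (ℬ : ℕ → Submodule k B)
    -- `B = ⊕_n B_n` is a graded bialgebra:
    (hinternal : DirectSum.IsInternal ℬ)
    (hmul : ∀ i j, ℬ i * ℬ j ≤ ℬ (i + j))
    (hcomul : ∀ (n : ℕ) (x : B), x ∈ ℬ n →
      Coalgebra.comul (R := k) x ∈ tensorGrade k B ℬ n)
    (hcounit : ∀ (n : ℕ) (x : B), x ∈ ℬ (n + 1) → Coalgebra.counit (R := k) x = (0 : k))
    -- `B` is connected, i.e. `B₀ = k·1`: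
    (hconn : ℬ 0 = (1 : Submodule k B))
    (r : ℕ) (ℓ : ℤ) (f : B ⊗[k] B →ₗ[k] B)
    -- `f` is homogeneous (of degree `ℓ`):
    (hhomog : HomogF k B ℬ ℓ f)
    -- `f` is unital:
    (hf1 : ∀ a : B, f ((1 : B) ⊗ₜ[k] a) = 0) (hf2 : ∀ a : B, f (a ⊗ₜ[k] (1 : B)) = 0)
    -- `f` is a Hochschild cocycle for the left and right regular actions:
    (hHochschild : ∀ a b c : B,
      a * f (b ⊗ₜ[k] c) - f ((a * b) ⊗ₜ[k] c) + f (a ⊗ₜ[k] (b * c)) - f (a ⊗ₜ[k] b) * c = 0)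
    -- `f_{<r} = 0`:
    (hlow : ∀ n < r, ∀ u ∈ tensorGrade k B ℬ n, f u = 0) :
    -- `f_r(1 ⊗ a) = 0`:
    (∀ (a : B) (u v : B ⊗[k] B), u ∈ tensorGrade k B ℬ r → v ∈ coGrade k B ℬ r →
      (1 : B) ⊗ₜ[k] a = u + v → f u = 0) ∧
    -- `f_r(a ⊗ 1) = 0`:
    (∀ (a : B) (u v : B ⊗[k] B), u ∈ tensorGrade k B ℬ r → v ∈ coGrade k B ℬ r →
      a ⊗ₜ[k] (1 : B) = u + v → f u = 0) ∧
    -- `f_r(xy ⊗ z) = f_r(x ⊗ yz)` for all `x, y, z ∈ B⁺`: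
    (∀ x y z : B, x ∈ Bplus k B → y ∈ Bplus k B → z ∈ Bplus k B →
      ∀ u v u' v' : B ⊗[k] B,
        u ∈ tensorGrade k B ℬ r → v ∈ coGrade k B ℬ r →
        u' ∈ tensorGrade k B ℬ r → v' ∈ coGrade k B ℬ r →
        (x * y) ⊗ₜ[k] z = u + v → x ⊗ₜ[k] (y * z) = u' + v' →
        f u = f u') := by
  obtain ⟨Q, hQ, hQ0⟩ := exists_tensorGrade_proj hinternal r
  have hQne : ∀ n ≠ r, ∀ w ∈ tensorGrade k B ℬ n, Q w = 0 := fun n hn w hw =>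
    hQ0 w (Submodule.mem_iSup_of_mem n (Submodule.mem_iSup_of_mem hn hw))
  have hfQ : ∀ w u v : B ⊗[k] B, u ∈ tensorGrade k B ℬ r → v ∈ coGrade k B ℬ r →
      w = u + v → f u = f (Q w) := by
    rintro w u v hu hv rfl
    rw [map_add, hQ u hu, hQ0 v hv, add_zero]
  have hfQ0 : ∀ n, ∀ w ∈ tensorGrade k B ℬ n, f w = 0 → f (Q w) = 0 := by
    intro n w hw hfw
    by_cases hn : n = r
    · subst hn
      rwa [hQ w hw]
    · rw [hQne n hn w hw, map_zero]
  have hone : (1 : B) ∈ ℬ 0 := hconn ▸ Submodule.one_le.mp le_rfl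
  have htop : ∀ a : B, a ∈ ⨆ n, ℬ n := fun a => by simp [hinternal.submodule_iSup_eq_top]
  have hleft : ∀ a : B, f (Q (1 ⊗ₜ[k] a)) = 0 := fun a => by
    refine Submodule.iSup_induction ℬ (motive := fun a => f (Q (1 ⊗ₜ[k] a)) = 0) (htop a)
      (fun n x hx => hfQ0 _ _ (tmul_mem_tensorGrade hone hx) (hf1 x)) (by simp)
      fun x y hx hy => ?_
    rw [tmul_add, map_add, map_add, hx, hy, add_zero]
  have hright : ∀ a : B, f (Q (a ⊗ₜ[k] 1)) = 0 := fun a => by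
    refine Submodule.iSup_induction ℬ (motive := fun a => f (Q (a ⊗ₜ[k] 1)) = 0) (htop a)
      (fun n x hx => hfQ0 _ _ (tmul_mem_tensorGrade hx hone) (hf2 x)) (by simp)
      fun x y hx hy => ?_
    rw [add_tmul, map_add, map_add, hx, hy, add_zero]
  have hhom : ∀ i j l, ∀ x ∈ ℬ (i + 1), ∀ y ∈ ℬ (j + 1), ∀ z ∈ ℬ (l + 1),
      f (Q ((x * y) ⊗ₜ[k] z)) = f (Q (x ⊗ₜ[k] (y * z))) := by
    intro i j l x hx y hy z hz
    have h1 := tmul_mem_tensorGrade (hmul _ _ (Submodule.mul_mem_mul hx hy)) hz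
    have h2 := tmul_mem_tensorGrade hx (hmul _ _ (Submodule.mul_mem_mul hy hz))
    rw [← add_assoc] at h2
    by_cases hr : i + 1 + (j + 1) + (l + 1) = r
    · have hyz : f (y ⊗ₜ[k] z) = 0 := hlow _ (by omega) _ (tmul_mem_tensorGrade hy hz)
      have hxy : f (x ⊗ₜ[k] y) = 0 := hlow _ (by omega) _ (tmul_mem_tensorGrade hx hy)
      have hc := hHochschild x y z
      rw [hyz, hxy, mul_zero, zero_mul, zero_sub, sub_zero, neg_add_eq_zero] at hc
      rw [hr] at h1 h2
      rw [hQ _ h1, hQ _ h2, hc]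
    · rw [hQne _ hr _ h1, hQne _ hr _ h2]
  have hplus := Bplus_le_iSup hinternal hcounit hconn
  refine ⟨fun a u v hu hv h => (hfQ _ u v hu hv h).trans (hleft a),
    fun a u v hu hv h => (hfQ _ u v hu hv h).trans (hright a),
    fun x y z hx hy hz u v u' v' hu hv hu' hv' h h' => ?_⟩
  rw [hfQ _ u v hu hv h, hfQ _ u' v' hu' hv' h']
  refine Submodule.iSup_induction _ (motive := fun x =>
    f (Q ((x * y) ⊗ₜ[k] z)) = f (Q (x ⊗ₜ[k] (y * z)))) (hplus hx) (fun i x hx => ?_) (by simp)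
    fun _ _ h₁ h₂ => by simp only [add_mul, add_tmul, map_add, h₁, h₂]
  refine Submodule.iSup_induction _ (motive := fun y =>
    f (Q ((x * y) ⊗ₜ[k] z)) = f (Q (x ⊗ₜ[k] (y * z)))) (hplus hy) (fun j y hy => ?_) (by simp)
    fun _ _ h₁ h₂ => by simp only [add_mul, mul_add, add_tmul, tmul_add, map_add, h₁, h₂]
  exact Submodule.iSup_induction _ (motive := fun z =>
    f (Q ((x * y) ⊗ₜ[k] z)) = f (Q (x ⊗ₜ[k] (y * z)))) (hplus hz)
    (fun l z hz => hhom i j l x hx y hy z hz) (by simp)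
    fun _ _ h₁ h₂ => by simp only [mul_add, tmul_add, map_add, h₁, h₂]

end
end Rigidity
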